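/- The pattern {x, x + y, x·y} is partition regular over ℕ: for every finite coloring c : ℕ → Fin r, there exist x, y ∈ ℕ (with x, y ≥ 1) such that x, x + y, and x·y all receive the same color under c. -/

import Mathlib

/-- Piecewise syndetic sets of natural numbers: the set has gaps bounded by some fixed `m`
inside arbitrarily long intervals. -/
def PiecewiseSyndetic (A : Set ℕ) : Prop :=
  ∃ m : ℕ, ∀ n : ℕ, ∃ a : ℕ, ∀ x, a ≤ x → x < a + n → ∃ f < m, x + f ∈ A

namespace PiecewiseSyndetic

theorem univ : PiecewiseSyndetic Set.univ :=
  ⟨1, fun _ => ⟨0, fun _ _ _ => ⟨0, Nat.one_pos, trivial⟩⟩⟩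

theorem exists_pos {A : Set ℕ} (hA : PiecewiseSyndetic A) : ∃ x ∈ A, 1 ≤ x := by
  obtain ⟨m, hm⟩ := hA
  obtain ⟨a, ha⟩ := hm 2
  obtain ⟨f, -, hf⟩ := ha (a + 1) (by omega) (by omega)
  exact ⟨_, hf, by omega⟩

theorem of_union {A B : Set ℕ} (h : PiecewiseSyndetic (A ∪ B)) :
    PiecewiseSyndetic A ∨ PiecewiseSyndetic B := by
  by_contra! hAB
  obtain ⟨hA, hB⟩ := hAB
  obtain ⟨m, hm⟩ := h
  refine hB ⟨m, fun n => ?_⟩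
  unfold PiecewiseSyndetic at hA
  push Not at hA
  obtain ⟨n', hn'⟩ := hA (n + m)
  obtain ⟨a, ha⟩ := hm (n' + n)
  obtain ⟨x, hax, hxa, hx⟩ := hn' a
  refine ⟨x, fun z hz hz' => ?_⟩
  obtain ⟨f, hf, hzf⟩ := ha z (by omega) (by omega)
  refine ⟨f, hf, hzf.resolve_left fun hzA => hx (z + f - x) (by omega) ?_⟩
  rwa [show x + (z + f - x) = z + f by omega]

theorem not_empty : ¬ PiecewiseSyndetic ∅ := fun h => by
  obtain ⟨x, hx, -⟩ := h.exists_pos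
  exact hx

theorem of_biUnion {ι : Type*} (s : Finset ι) (B : ι → Set ℕ)
    (h : PiecewiseSyndetic (⋃ i ∈ s, B i)) : ∃ i ∈ s, PiecewiseSyndetic (B i) := by
  classical
  induction s using Finset.induction_on with
  | empty => exact absurd (by simpa using h) not_empty
  | insert i s _ ih =>
    rw [Finset.set_biUnion_insert] at h
    rcases h.of_union with h | h
    · exact ⟨i, Finset.mem_insert_self _ _, h⟩
    · obtain ⟨j, hj, hB⟩ := ih h
      exact ⟨j, Finset.mem_insert_of_mem hj, hB⟩

theorem image_mul_left {A : Set ℕ} (hA : PiecewiseSyndetic A) {y : ℕ} (hy : 1 ≤ y) :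
    PiecewiseSyndetic ((fun a => y * a) '' A) := by
  obtain ⟨m, hm⟩ := hA
  refine ⟨y * m + y, fun n => ?_⟩
  obtain ⟨a, ha⟩ := hm (n + 1)
  refine ⟨y * a, fun x hx hxn => ?_⟩
  have h₁ : y * (x / y) + x % y = x := Nat.div_add_mod x y
  have h₂ : x % y < y := Nat.mod_lt _ hy
  have h₃ : a ≤ x / y := (Nat.le_div_iff_mul_le hy).2 (by linarith)
  have h₄ : x / y < a + n := by
    by_contra! h
    have := Nat.mul_le_mul_left y h
    have := Nat.le_mul_of_pos_left n hy
    rw [Nat.mul_add] at *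
    omega
  obtain ⟨f, hf, hfA⟩ := ha (x / y + 1) (by omega) (by omega)
  have h₅ : y * (x / y + 1 + f) = y * (x / y) + y + y * f := by ring
  have h₆ : y * f < y * m := Nat.mul_lt_mul_of_pos_left hf hy
  refine ⟨y * (x / y + 1 + f) - x, by omega, x / y + 1 + f, hfA, ?_⟩
  change y * (x / y + 1 + f) = _
  omega

end PiecewiseSyndetic

open Combinatorics in
/-- A finitary **van der Waerden theorem** for homothetic copies of a finite set. -/
theorem exists_bound_mono_homothetic_copy (S : Finset ℕ) (κ : Type*) [Finite κ] :
    ∃ N : ℕ, ∀ C : ℕ → κ, ∃ y b : ℕ, 1 ≤ y ∧ y ≤ N ∧ ∃ k, ∀ s ∈ S,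
      b + s * y ≤ N ∧ C (b + s * y) = k := by
  classical
  obtain ⟨ι, _, hι⟩ := Line.exists_mono_in_high_dimension S κ
  refine ⟨Fintype.card ι * (S.sup id + 1), fun C => ?_⟩
  obtain ⟨l, k, hl⟩ := hι fun v => C (∑ i, (v i : ℕ))
  set y := (Finset.univ.filter fun i => l.idxFun i = none).card
  have hsum : ∀ s : S, ∑ i, (l s i : ℕ) =
      ∑ i, ((l.idxFun i).map Subtype.val).getD 0 + (s : ℕ) * y := by
    intro s
    rw [mul_comm, ← smul_eq_mul, ← Finset.sum_const, Finset.sum_filter, ← Finset.sum_add_distrib]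
    refine Finset.sum_congr rfl fun i _ => ?_
    rw [Line.coe_apply]
    cases l.idxFun i <;> simp
  refine ⟨y, ∑ i, ((l.idxFun i).map Subtype.val).getD 0, ?_, ?_, k, fun s hs => ?_⟩
  · obtain ⟨i, hi⟩ := l.proper
    exact Finset.card_pos.2 ⟨i, by simpa using hi⟩
  · exact (Finset.card_le_univ _).trans (Nat.le_mul_of_pos_right _ (Nat.succ_pos _))
  · rw [← hsum ⟨s, hs⟩]
    refine ⟨?_, hl ⟨s, hs⟩⟩
    rw [← smul_eq_mul]
    refine Finset.sum_le_card_nsmul _ _ _ fun i _ => ?_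
    exact (Finset.le_sup (f := id) (l ⟨s, hs⟩ i).2).trans (Nat.le_succ _)

theorem PiecewiseSyndetic.exists_inter_shifts {A : Set ℕ} (hA : PiecewiseSyndetic A)
    (S : Finset ℕ) :
    ∃ y, 1 ≤ y ∧ PiecewiseSyndetic {a | a ∈ A ∧ ∀ s ∈ S, a + s * y ∈ A} := by
  obtain ⟨m, hm⟩ := hA
  obtain ⟨N, hN⟩ := exists_bound_mono_homothetic_copy (insert 0 S) (Fin (m + 1))
  suffices h : PiecewiseSyndetic
      (⋃ y ∈ Finset.Icc 1 N, {a | a ∈ A ∧ ∀ s ∈ S, a + s * y ∈ A}) by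
    obtain ⟨y, hy, h⟩ := of_biUnion _ _ h
    exact ⟨y, (Finset.mem_Icc.1 hy).1, h⟩
  refine ⟨N + m + 1, fun n => ?_⟩
  obtain ⟨a, ha⟩ := hm (n + N + 1)
  refine ⟨a, fun x hx hxn => ?_⟩
  have hC : ∀ u, ∃ f : Fin (m + 1), u ≤ N → x + u + f ∈ A := by
    intro u
    by_cases hu : u ≤ N
    · obtain ⟨f, hf, hfA⟩ := ha (x + u) (by omega) (by omega)
      exact ⟨⟨f, by omega⟩, fun _ => hfA⟩
    · exact ⟨0, fun h => absurd h hu⟩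
  choose C hC using hC
  obtain ⟨y, b, hy, hyN, k, hk⟩ := hN C
  have key : ∀ s ∈ insert 0 S, x + (b + k) + s * y ∈ A := by
    intro s hs
    obtain ⟨hle, heq⟩ := hk s hs
    have := hC _ hle
    rw [heq] at this
    rwa [show x + (b + k) + s * y = x + (b + s * y) + k by ring]
  have hb := (hk 0 (Finset.mem_insert_self _ _)).1
  refine ⟨b + k, by omega, ?_⟩
  simp only [Set.mem_iUnion, Finset.mem_Icc]
  refine ⟨y, ⟨hy, hyN⟩, ?_, fun s hs => key s (Finset.mem_insert_of_mem hs)⟩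
  simpa using key 0 (Finset.mem_insert_self _ _)

theorem PiecewiseSyndetic.exists_add_mul_mono {κ : Type*} [Fintype κ] [DecidableEq κ] (c : ℕ → κ)
    (K : Finset κ) (B : Set ℕ) (hB : PiecewiseSyndetic B) (p : κ → ℕ) (hp : ∀ t ∈ K, 1 ≤ p t)
    (hK : ∀ t ∈ K, ∀ b ∈ B, ∃ x, b = p t * x ∧ c x = t) :
    ∃ x y : ℕ, 1 ≤ x ∧ 1 ≤ y ∧ c (x + y) = c x ∧ c (x * y) = c x := by
  induction h : (Finset.univ \ K).card using Nat.strong_induction_on generalizing K B p with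
  | _ n ih =>
  subst h
  obtain ⟨y, hy, hD⟩ := hB.exists_inter_shifts (K.image fun t => p t ^ 2)
  set D := {a | a ∈ B ∧ ∀ s ∈ K.image fun t => p t ^ 2, a + s * y ∈ B}
  obtain ⟨t, -, ht⟩ := of_biUnion Finset.univ
      (fun t => {b | b ∈ (fun a => y * a) '' D ∧ c b = t}) <| by
    convert hD.image_mul_left hy using 1
    ext b
    simp
  by_cases htK : t ∈ K
  · obtain ⟨_, ⟨⟨d, ⟨hdB, hd⟩, rfl⟩, hc⟩, hpos⟩ := ht.exists_pos
    dsimp only at hc hpos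
    obtain ⟨x, rfl, hx⟩ := hK t htK d hdB
    obtain ⟨x', hx', hcx'⟩ := hK t htK _ (hd _ (Finset.mem_image_of_mem _ htK))
    have hpt := hp t htK
    have : x + p t * y = x' := by
      refine Nat.eq_of_mul_eq_mul_left hpt ?_
      rw [← hx']
      ring
    refine ⟨x, p t * y, ?_, Nat.mul_pos hpt hy, by rw [this, hcx', hx], ?_⟩
    · rcases Nat.eq_zero_or_pos x with rfl | h
      · simp at hpos
      · exact h
    · rw [hx, show x * (p t * y) = y * (p t * x) by ring, hc]
  · refine ih _ ?_ (insert t K) _ ht (fun s => if s = t then 1 else p s * y) ?_ ?_ rfl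
    · refine Finset.card_lt_card (Finset.ssubset_iff_subset_ne.2 ⟨by grind, fun h => ?_⟩)
      have : t ∈ Finset.univ \ K := by simpa using htK
      rw [← h] at this
      simp at this
    · intro s hs
      split_ifs with hst
      · exact le_rfl
      · exact Nat.mul_pos (hp s ((Finset.mem_insert.1 hs).resolve_left hst)) hy
    · rintro s hs _ ⟨⟨d, ⟨hdB, -⟩, rfl⟩, hc⟩
      dsimp only at hc ⊢
      split_ifs with hst
      · exact ⟨y * d, by ring, by rw [hc, hst]⟩
      · obtain ⟨x, rfl, hx⟩ := hK s ((Finset.mem_insert.1 hs).resolve_left hst) d hdB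
        exact ⟨x, by ring, hx⟩

theorem moreira (r : ℕ) (c : ℕ → Fin r) :
    ∃ x y : ℕ, 1 ≤ x ∧ 1 ≤ y ∧ c (x + y) = c x ∧ c (x * y) = c x := by
  exact PiecewiseSyndetic.univ.exists_add_mul_mono c ∅ _ (fun _ => 1) (by simp) (by simp)
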